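/- Let (𝒫, ℒ) and (𝒫′, ℒ′) be linear spaces with dim(𝒫, ℒ) ≥ 3 and dim(𝒫′, ℒ′) ≥ 3, and let φ : ℒ → ℒ′ be a bijection such that a ∼ b if and only if φ(a) ∼′ φ(b) for all a, b ∈ ℒ. If φ maps some star of lines of (𝒫, ℒ) onto a star of lines of (𝒫′, ℒ′), then the map κ : 𝒫 → 𝒫′ sending, for adjacent lines a, b ∈ ℒ, the unique point of a ∩ b to the unique point of φ(a) ∩ φ(b), is a well-defined collineation from (𝒫, ℒ) onto (𝒫′, ℒ′). -/

import Mathlib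

/-- A linear space: a point set `P` together with a set of lines (subsets of `P`),
each line having at least two points, and any two distinct points lying on
exactly one line. -/
structure LinearSpace (P : Type*) where
  lines : Set (Set P)
  two_points : ∀ l ∈ lines, ∃ A B : P, A ≠ B ∧ A ∈ l ∧ B ∈ l
  unique_line : ∀ A B : P, A ≠ B → ∃! l, l ∈ lines ∧ A ∈ l ∧ B ∈ l

namespace LinearSpace

variable {P : Type*} (LS : LinearSpace P)

/-- A subspace: a subset containing, with any two of its distinct points,
the line joining them. -/
def IsSubspace (S : Set P) : Prop :=
  ∀ l ∈ LS.lines, ∀ A ∈ l, ∀ B ∈ l, A ≠ B → A ∈ S → B ∈ S → l ⊆ S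

/-- The span of a subset: the intersection of all subspaces containing it. -/
def span (S : Set P) : Set P :=
  ⋂₀ {T | LS.IsSubspace T ∧ S ⊆ T}

/-- The dimension of a subset `S` (intended for subspaces):
`min {#X - 1 | X ⊆ S, span X = S}` as an extended natural number. -/
noncomputable def sdim (S : Set P) : ℕ∞ :=
  sInf {d : ℕ∞ | ∃ X : Set P, X ⊆ S ∧ LS.span X = S ∧ d = X.encard - 1}

/-- The dimension of the linear space: `min {#X - 1 | span X = P}`. -/
noncomputable def dim : ℕ∞ := LS.sdim Set.univ

/-- A plane is a 2-dimensional subspace. -/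
def IsPlane (E : Set P) : Prop := LS.IsSubspace E ∧ LS.sdim E = 2

/-- A generalized projective space: every plane is a generalized projective
plane, i.e. any two distinct lines contained in a common plane meet. -/
def IsGenProjSpace : Prop :=
  ∀ E : Set P, LS.IsPlane E →
    ∀ l ∈ LS.lines, ∀ m ∈ LS.lines, l ⊆ E → m ⊆ E → l ≠ m → (l ∩ m).Nonempty

/-- A related set: a set of lines which pairwise meet. -/
def IsRelatedSet (N : Set (Set P)) : Prop :=
  N ⊆ LS.lines ∧ ∀ a ∈ N, ∀ b ∈ N, (a ∩ b).Nonempty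

/-- A maximal related set: a related set maximal with respect to inclusion. -/
def IsMaxRelatedSet (M : Set (Set P)) : Prop :=
  LS.IsRelatedSet M ∧ ∀ N, LS.IsRelatedSet N → M ⊆ N → N = M

/-- The star of lines with vertex `A`: all lines through `A`. -/
def star (A : P) : Set (Set P) := {l | l ∈ LS.lines ∧ A ∈ l}

/-- The pencil of planes with axis `a`: all planes containing `a`. -/
def pencil (a : Set P) : Set (Set P) := {E | LS.IsPlane E ∧ a ⊆ E}

/-- A collineation: a bijection of the point sets mapping each line onto a
line, and whose inverse does likewise. -/
def IsCollineation {P' : Type*} (LS' : LinearSpace P') (κ : P → P') : Prop :=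
  Function.Bijective κ ∧ (∀ l ∈ LS.lines, κ '' l ∈ LS'.lines) ∧
    (∀ l' ∈ LS'.lines, κ ⁻¹' l' ∈ LS.lines)

end LinearSpace

namespace LinearSpace

variable {P P' : Type*} {LS : LinearSpace P} {LS' : LinearSpace P'}

theorem line_eq {l m : Set P} (hl : l ∈ LS.lines) (hm : m ∈ LS.lines) {X Y : P} (hXY : X ≠ Y)
    (hXl : X ∈ l) (hYl : Y ∈ l) (hXm : X ∈ m) (hYm : Y ∈ m) : l = m :=
  (LS.unique_line X Y hXY).unique ⟨hl, hXl, hYl⟩ ⟨hm, hXm, hYm⟩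

theorem exists_line (LS : LinearSpace P) {X Y : P} (hXY : X ≠ Y) :
    ∃ l ∈ LS.lines, X ∈ l ∧ Y ∈ l :=
  (LS.unique_line X Y hXY).exists

theorem exists_mem_ne {l : Set P} (hl : l ∈ LS.lines) (X : P) : ∃ Y ∈ l, Y ≠ X := by
  obtain ⟨A, B, hAB, hA, hB⟩ := LS.two_points l hl
  by_cases h : A = X
  · exact ⟨B, hB, fun h' => hAB (h.trans h'.symm)⟩
  · exact ⟨A, hA, h⟩

theorem subset_span (S : Set P) : S ⊆ LS.span S :=
  Set.subset_sInter fun _ h => h.2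

theorem isSubspace_span (S : Set P) : LS.IsSubspace (LS.span S) :=
  fun l hl X hX Y hY hXY hXS hYS => Set.subset_sInter fun T hT =>
    hT.1 l hl X hX Y hY hXY (hXS T hT) (hYS T hT)

theorem span_subset {S T : Set P} (h : S ⊆ LS.span T) : LS.span S ⊆ LS.span T :=
  Set.sInter_subset_of_mem ⟨isSubspace_span T, h⟩

theorem exists_notMem_span_triple (hdim : 3 ≤ LS.dim) (A B C : P) :
    ∃ D, D ∉ LS.span {A, B, C} := by
  by_contra! h
  have hle : LS.dim ≤ ({A, B, C} : Set P).encard - 1 :=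
    sInf_le ⟨_, Set.subset_univ _, Set.eq_univ_of_forall h, rfl⟩
  have hcard : ({A, B, C} : Set P).encard ≤ 3 :=
    calc ({A, B, C} : Set P).encard ≤ ({B, C} : Set P).encard + 1 := Set.encard_insert_le _ _
      _ ≤ ({C} : Set P).encard + 1 + 1 := by gcongr; exact Set.encard_insert_le _ _
      _ = 3 := by rw [Set.encard_singleton]; rfl
  exact absurd (hdim.trans (hle.trans (tsub_le_tsub_right hcard 1))) (by decide)

theorem exists_two_lines (hdim : 3 ≤ LS.dim) {A B : P} {l : Set P} (hl : l ∈ LS.lines)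
    (hAB : A ≠ B) (hA : A ∈ l) (hB : B ∈ l) (C : P) :
    ∃ D, D ∉ LS.span {A, B, C} ∧ ∃ d ∈ LS.lines, B ∈ d ∧ D ∈ d ∧ d ≠ l := by
  obtain ⟨D, hD⟩ := exists_notMem_span_triple hdim A B C
  have hBD : B ≠ D := by
    rintro rfl
    exact hD (subset_span _ (by simp))
  obtain ⟨d, hd, hBd, hDd⟩ := LS.exists_line hBD
  refine ⟨D, hD, d, hd, hBd, hDd, ?_⟩
  rintro rfl
  exact hD (isSubspace_span _ d hd A hA B hB hAB (subset_span _ (by simp))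
    (subset_span _ (by simp)) hDd)

theorem eq_of_star_subset_star (hdim : 3 ≤ LS.dim) {A B : P} (h : LS.star A ⊆ LS.star B) :
    A = B := by
  by_contra hne
  obtain ⟨l, hl, hA, hB⟩ := LS.exists_line hne
  obtain ⟨D, -, d, hd, hAd, -, hdl⟩ := exists_two_lines hdim hl (Ne.symm hne) hB hA A
  exact hdl (line_eq hd hl hne hAd (h ⟨hd, hAd⟩).2 hA hB)

/-- A bijection of line sets that preserves relatedness in both directions. -/
structure IsPlueckerMap (LS : LinearSpace P) (LS' : LinearSpace P')
    (φ : Set P → Set P') : Prop where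
  bijOn : Set.BijOn φ LS.lines LS'.lines
  inter_nonempty_iff : ∀ a ∈ LS.lines, ∀ b ∈ LS.lines,
    ((a ∩ b).Nonempty ↔ (φ a ∩ φ b).Nonempty)

namespace IsPlueckerMap

variable {φ : Set P → Set P'} {A : P} {A' : P'}

theorem inverse (h : IsPlueckerMap LS LS' φ) {ψ : Set P' → Set P}
    (hinv : Set.InvOn ψ φ LS.lines LS'.lines) : IsPlueckerMap LS' LS ψ := by
  have hψ : Set.BijOn ψ LS'.lines LS.lines := h.bijOn.symm hinv.symm
  refine ⟨hψ, fun a ha b hb => ?_⟩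
  rw [h.inter_nonempty_iff _ (hψ.mapsTo ha) _ (hψ.mapsTo hb), hinv.2 ha, hinv.2 hb]

theorem mem_star_iff (h : IsPlueckerMap LS LS' φ) (hA : φ '' LS.star A = LS'.star A')
    {l : Set P} (hl : l ∈ LS.lines) : A' ∈ φ l ↔ A ∈ l := by
  constructor
  · intro hl'
    obtain ⟨m, hm, hml⟩ := hA.ge ⟨h.bijOn.mapsTo hl, hl'⟩
    exact h.bijOn.injOn hm.1 hl hml ▸ hm.2
  · intro hAl
    exact (hA.le ⟨l, ⟨hl, hAl⟩, rfl⟩).2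

/-- If the line `c` leaves the plane spanned by `l` and `b`, where `b`, `c`, `l` are concurrent and
the star with vertex `A ∈ l` is mapped to a star, then the images of `b`, `c`, `l` are concurrent. -/
theorem concurrent_of_notMem_span (h : IsPlueckerMap LS LS' φ)
    (hA : φ '' LS.star A = LS'.star A') {B U D : P} {l b c : Set P}
    (hl : l ∈ LS.lines) (hb : b ∈ LS.lines) (hc : c ∈ LS.lines) (hAB : A ≠ B)
    (hAl : A ∈ l) (hBl : B ∈ l) (hBb : B ∈ b) (hBc : B ∈ c) (hbl : b ≠ l) (hcl : c ≠ l)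
    (hUb : U ∈ b) (hUB : U ≠ B) (hDc : D ∈ c) (hD : D ∉ LS.span {A, B, U})
    {Y Z : P'} (hYb : Y ∈ φ b) (hYl : Y ∈ φ l) (hZc : Z ∈ φ c) (hZl : Z ∈ φ l) : Y = Z := by
  by_contra hYZ
  have hAS : A ∈ LS.span {A, B, U} := subset_span _ (by simp)
  have hBS : B ∈ LS.span {A, B, U} := subset_span _ (by simp)
  have hUS : U ∈ LS.span {A, B, U} := subset_span _ (by simp)
  have hbS : b ⊆ LS.span {A, B, U} := isSubspace_span _ b hb U hUb B hBb hUB hUS hBS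
  have hAb : A ∉ b := fun hAb => hbl (line_eq hb hl hAB hAb hBb hAl hBl)
  have hbc : b ≠ c := by
    rintro rfl
    exact hD (hbS hDc)
  have hφl := h.bijOn.mapsTo hl
  have hφb := h.bijOn.mapsTo hb
  have hφc := h.bijOn.mapsTo hc
  obtain ⟨W, hWb, hWc⟩ := (h.inter_nonempty_iff b hb c hc).1 ⟨B, hBb, hBc⟩
  have hWl : W ∉ φ l := by
    intro hWl
    have hWY : W = Y := by
      by_contra hne
      exact hbl (h.bijOn.injOn hb hl (line_eq hφb hφl hne hWb hYb hWl hYl))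
    have hWZ : W = Z := by
      by_contra hne
      exact hcl (h.bijOn.injOn hc hl (line_eq hφc hφl hne hWc hZc hWl hZl))
    exact hYZ (hWY.symm.trans hWZ)
  have hAW : A' ≠ W := by
    rintro rfl
    exact hAb ((h.mem_star_iff hA hb).1 hWb)
  obtain ⟨m', hm', hAm', hWm'⟩ := LS'.exists_line hAW
  obtain ⟨m, ⟨hm, hAm⟩, rfl⟩ := hA.ge ⟨hm', hAm'⟩
  have hBm : B ∉ m := fun hBm => hWl (line_eq hm hl hAB hAm hBm hAl hBl ▸ hWm')
  obtain ⟨X, hXm, hXb⟩ := (h.inter_nonempty_iff m hm b hb).2 ⟨W, hWm', hWb⟩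
  obtain ⟨V, hVm, hVc⟩ := (h.inter_nonempty_iff m hm c hc).2 ⟨W, hWm', hWc⟩
  have hAX : A ≠ X := fun hAX => hAb (hAX ▸ hXb)
  have hVB : V ≠ B := fun hVB => hBm (hVB ▸ hVm)
  have hVS := isSubspace_span _ m hm A hAm X hXm hAX hAS (hbS hXb) hVm
  exact hD (isSubspace_span _ c hc V hVc B hBc hVB hVS hBS hDc)

theorem exists_image_star_subset (h : IsPlueckerMap LS LS' φ) (hdim : 3 ≤ LS.dim)
    (hA : φ '' LS.star A = LS'.star A') (B : P) :
    ∃ B', φ '' LS.star B ⊆ LS'.star B' := by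
  by_cases hAB : A = B
  · exact ⟨A', hAB ▸ hA.le⟩
  obtain ⟨l, hl, hAl, hBl⟩ := LS.exists_line hAB
  obtain ⟨U, hU, b, hb, hBb, hUb, hbl⟩ := exists_two_lines hdim hl hAB hAl hBl B
  have hUB : U ≠ B := by
    rintro rfl
    exact hU (subset_span _ (by simp))
  obtain ⟨Y, hYb, hYl⟩ := (h.inter_nonempty_iff b hb l hl).1 ⟨B, hBb, hBl⟩
  refine ⟨Y, ?_⟩
  rintro _ ⟨c, ⟨hc, hBc⟩, rfl⟩
  refine ⟨h.bijOn.mapsTo hc, ?_⟩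
  by_cases hcl : c = l
  · exact hcl ▸ hYl
  obtain ⟨V, hVc, hVB⟩ := exists_mem_ne hc B
  obtain ⟨Z, hZc, hZl⟩ := (h.inter_nonempty_iff c hc l hl).1 ⟨B, hBc, hBl⟩
  suffices Y = Z from this ▸ hZc
  by_cases hV : V ∈ LS.span {A, B, U}
  · obtain ⟨D, hD, d, hd, hBd, hDd, hdl⟩ := exists_two_lines hdim hl hAB hAl hBl U
    have hDV : D ∉ LS.span {A, B, V} := fun hDV => hD <| span_subset (by
      rintro X (rfl | rfl | rfl)
      · exact subset_span _ (by simp)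
      · exact subset_span _ (by simp)
      · exact hV) hDV
    obtain ⟨T, hTd, hTl⟩ := (h.inter_nonempty_iff d hd l hl).1 ⟨B, hBd, hBl⟩
    exact (h.concurrent_of_notMem_span hA hl hb hd hAB hAl hBl hBb hBd hbl hdl hUb hUB hDd hD
      hYb hYl hTd hTl).trans
      (h.concurrent_of_notMem_span hA hl hc hd hAB hAl hBl hBc hBd hcl hdl hVc hVB hDd hDV
      hZc hZl hTd hTl).symm
  · exact h.concurrent_of_notMem_span hA hl hb hc hAB hAl hBl hBb hBc hbl hcl hUb hUB hVc hV
      hYb hYl hZc hZl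

theorem exists_image_star_eq (h : IsPlueckerMap LS LS' φ) (hdim : 3 ≤ LS.dim)
    (hdim' : 3 ≤ LS'.dim) (hA : φ '' LS.star A = LS'.star A') (B : P) :
    ∃ B', φ '' LS.star B = LS'.star B' := by
  obtain ⟨ψ, hinv⟩ : ∃ ψ, Set.InvOn ψ φ LS.lines LS'.lines :=
    ⟨_, h.bijOn.invOn_invFunOn⟩
  have hψA : ψ '' LS'.star A' = LS.star A := by
    rw [← hA]
    exact hinv.1.image_image' fun _ hl => hl.1
  obtain ⟨B', hB'⟩ := h.exists_image_star_subset hdim hA B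
  obtain ⟨C, hC⟩ := (h.inverse hinv).exists_image_star_subset hdim' hψA B'
  have hBC : B = C := eq_of_star_subset_star hdim fun l hl =>
    hinv.1 hl.1 ▸ hC ⟨φ l, hB' ⟨l, hl, rfl⟩, rfl⟩
  subst hBC
  exact ⟨B', hB'.antisymm fun l hl => ⟨ψ l, hC ⟨l, hl, rfl⟩, hinv.2 hl.1⟩⟩

theorem exists_isCollineation (h : IsPlueckerMap LS LS' φ) (hdim : 3 ≤ LS.dim)
    (hdim' : 3 ≤ LS'.dim) (hA : φ '' LS.star A = LS'.star A') :
    ∃ κ : P → P', LS.IsCollineation LS' κ ∧ ∀ l ∈ LS.lines, ∀ X, κ X ∈ φ l ↔ X ∈ l := by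
  choose κ hκ using h.exists_image_star_eq hdim hdim' hA
  have hmem : ∀ l ∈ LS.lines, ∀ X, κ X ∈ φ l ↔ X ∈ l :=
    fun l hl X => h.mem_star_iff (hκ X) hl
  obtain ⟨ψ, hinv⟩ : ∃ ψ, Set.InvOn ψ φ LS.lines LS'.lines :=
    ⟨_, h.bijOn.invOn_invFunOn⟩
  have hψA : ψ '' LS'.star A' = LS.star A := by
    rw [← hA]
    exact hinv.1.image_image' fun _ hl => hl.1
  have hinj : Function.Injective κ := fun X Y hXY =>
    eq_of_star_subset_star hdim fun l hl =>
      ⟨hl.1, (hmem l hl.1 Y).1 (hXY ▸ (hmem l hl.1 X).2 hl.2)⟩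
  have hsurj : Function.Surjective κ := by
    intro X'
    obtain ⟨X, hX⟩ := (h.inverse hinv).exists_image_star_subset hdim' hψA X'
    refine ⟨X, (eq_of_star_subset_star hdim' fun l hl => ⟨hl.1, ?_⟩).symm⟩
    have hl' := hX ⟨l, hl, rfl⟩
    exact hinv.2 hl.1 ▸ (hmem _ hl'.1 X).2 hl'.2
  have hpre : ∀ l ∈ LS.lines, κ ⁻¹' φ l = l := fun l hl => Set.ext (hmem l hl)
  refine ⟨κ, ⟨⟨hinj, hsurj⟩, fun l hl => ?_, fun l' hl' => ?_⟩, hmem⟩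
  · have himage := Set.image_preimage_eq (φ l) hsurj
    rw [hpre l hl] at himage
    exact himage ▸ h.bijOn.mapsTo hl
  · obtain ⟨l, hl, rfl⟩ := h.bijOn.surjOn hl'
    exact (hpre l hl).symm ▸ hl

end IsPlueckerMap

end LinearSpace

/-- If a relatedness-preserving line bijection `φ` (both directions, dimensions
at least 3) maps some star of lines onto a star of lines, then the map `κ`
sending, for adjacent lines `a, b`, the point `a ∩ b` to the point
`φ a ∩ φ b` is a well-defined collineation. -/
theorem collineation_of_star_to_star
    {P P' : Type*} (LS : LinearSpace P) (LS' : LinearSpace P')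
    (hdim : 3 ≤ LS.dim) (hdim' : 3 ≤ LS'.dim)
    (φ : Set P → Set P') (hbij : Set.BijOn φ LS.lines LS'.lines)
    (hrel : ∀ a ∈ LS.lines, ∀ b ∈ LS.lines,
      ((a ∩ b).Nonempty ↔ (φ a ∩ φ b).Nonempty))
    (hstar : ∃ (A : P) (A' : P'), φ '' LS.star A = LS'.star A') :
    ∃ κ : P → P', LS.IsCollineation LS' κ ∧
      ∀ a ∈ LS.lines, ∀ b ∈ LS.lines, a ≠ b →
        ∀ X : P, X ∈ a → X ∈ b → κ X ∈ φ a ∧ κ X ∈ φ b := by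
  obtain ⟨A, A', hA⟩ := hstar
  obtain ⟨κ, hκ, hmem⟩ :=
    LinearSpace.IsPlueckerMap.exists_isCollineation ⟨hbij, hrel⟩ hdim hdim' hA
  exact ⟨κ, hκ, fun a ha b hb _ X hXa hXb => ⟨(hmem a ha X).2 hXa, (hmem b hb X).2 hXb⟩⟩
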